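/- Let α be real with 0 < α < 1 and set β = (1 + √α)/2. Then there do not exist a measurable space Λ, probability measures x, X, z, Z, ν on Λ, and measurable sets A, B ⊆ Λ such that: ν = ½x + ½X and ν = ½z + ½Z (as measures); x(A) = 1 and X(A) = 0; x(B) = α; z(A) = β and z(B) = β; and Z(A) = 1 − β and Z(B) = 1 − β. -/

import Mathlib

open MeasureTheory
open scoped ENNReal

/-- Measure-theoretic three-ensemble steering contradiction: for `0 < α < 1`
and `β = (1+√α)/2` there are no probability measures `x, X, z, Z, ν` with
`ν = ½x + ½X = ½z + ½Z`, `x(A) = 1`, `X(A) = 0`, `x(B) = α`,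
`z(A) = z(B) = β`, `Z(A) = Z(B) = 1-β`. -/
theorem steering_three_ensembles_no_lhv_measure (α : ℝ)
    (hα0 : 0 < α) (hα1 : α < 1) (β : ℝ) (hβ : β = (1 + Real.sqrt α) / 2) :
    ¬ ∃ (Λ : Type) (_ : MeasurableSpace Λ) (x X z Z ν : Measure Λ)
      (_ : IsProbabilityMeasure x) (_ : IsProbabilityMeasure X)
      (_ : IsProbabilityMeasure z) (_ : IsProbabilityMeasure Z)
      (_ : IsProbabilityMeasure ν) (A B : Set Λ),
        MeasurableSet A ∧ MeasurableSet B ∧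
        ν = (2 : ℝ≥0∞)⁻¹ • x + (2 : ℝ≥0∞)⁻¹ • X ∧
        ν = (2 : ℝ≥0∞)⁻¹ • z + (2 : ℝ≥0∞)⁻¹ • Z ∧
        x A = 1 ∧ X A = 0 ∧
        x B = ENNReal.ofReal α ∧
        z A = ENNReal.ofReal β ∧ z B = ENNReal.ofReal β ∧
        Z A = ENNReal.ofReal (1 - β) ∧ Z B = ENNReal.ofReal (1 - β) := by
  rintro ⟨Λ, _, x, X, z, Z, ν, _, _, _, _, _, A, B, hA, hB, h1, h2, -, hXA, hxB, hzA, hzB, -, -⟩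
  have e1 : ν.real (A ∩ B) = 2⁻¹ * x.real (A ∩ B) + 2⁻¹ * X.real (A ∩ B) := by
    rw [h1, Measure.real, Measure.add_apply, Measure.smul_apply, Measure.smul_apply,
      smul_eq_mul, smul_eq_mul, ENNReal.toReal_add (by finiteness) (by finiteness)]
    simp [Measure.real]
  have e2 : ν.real (A ∩ B) = 2⁻¹ * z.real (A ∩ B) + 2⁻¹ * Z.real (A ∩ B) := by
    rw [h2, Measure.real, Measure.add_apply, Measure.smul_apply, Measure.smul_apply,
      smul_eq_mul, smul_eq_mul, ENNReal.toReal_add (by finiteness) (by finiteness)]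
    simp [Measure.real]
  have hs : 0 < Real.sqrt α := Real.sqrt_pos.mpr hα0
  have hsq : Real.sqrt α * Real.sqrt α = α := Real.mul_self_sqrt hα0.le
  have hX : X.real (A ∩ B) = 0 := by
    simp [Measure.real, measure_mono_null Set.inter_subset_left hXA]
  have hx : x.real (A ∩ B) ≤ α := by
    refine (measureReal_mono Set.inter_subset_right).trans ?_
    rw [Measure.real, hxB, ENNReal.toReal_ofReal hα0.le]
  have hβ0 : 0 ≤ β := by rw [hβ]; positivity
  have za : z.real A = β := by rw [Measure.real, hzA, ENNReal.toReal_ofReal hβ0]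
  have zb : z.real B = β := by rw [Measure.real, hzB, ENNReal.toReal_ofReal hβ0]
  have hu : z.real (A ∪ B) + z.real (A ∩ B) = z.real A + z.real B :=
    measureReal_union_add_inter hB
  have hu1 : z.real (A ∪ B) ≤ 1 := measureReal_le_one
  have hZ : 0 ≤ Z.real (A ∩ B) := measureReal_nonneg
  have hle : Real.sqrt α ≤ α := by linarith
  have hlt : Real.sqrt α < 1 := by
    rw [Real.sqrt_lt' one_pos]; simpa using hα1
  nlinarith
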